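/- Let X be a T1-space, X_d its discretization, and let G be a (para)topological group containing X such that X generates G freely as an abelian group (G = AP(X)). Define f : ((X_d × X) ⊕ (X × X_d) ⊕ {(e,e)}) → G by f(x,y) = -x + y on X_d × X, f(x,y) = x - y on X × X_d, and f(e,e) = e. If the restriction of f to the preimage of {w ∈ G : w has reduced length exactly 2} is open, then for every closed set E in the domain disjoint from the preimage of the identity's neighborhood-reachable words of length ≤ 1, any point w of reduced length 2 in the closure of f(E) lies in f(E). -/

import Mathlib

open FreeAbelianGroup in
/-- Words of reduced length exactly 2 and coefficient-sum 0 in the free abelian group: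
`-x + y` or `x - y` with `x ≠ y`. -/
def LenTwoZero (X : Type*) : Set (FreeAbelianGroup X) :=
  {w | ∃ x y : X, x ≠ y ∧ (w = -of x + of y ∨ w = of x - of y)}

open FreeAbelianGroup in
/-- The map `f` from `(X_d × X) ⊕ (X × X_d) ⊕ {e}` into the free abelian group on `X`,
sending `(x,y)` in the first summand to `-x + y`, `(x,y)` in the second to `x - y`,
and the extra point to `0`. -/
def theMap (X : Type*) : (X × X) ⊕ (X × X) ⊕ Unit → FreeAbelianGroup X :=
  Sum.elim (fun p => -of p.1 + of p.2)
    (Sum.elim (fun p => of p.1 - of p.2) (fun _ => 0))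

theorem aux_open {X Y T : Type*} [TopologicalSpace X] [TopologicalSpace Y] [TopologicalSpace T]
    (E : Set ((Y × X) ⊕ (X × Y) ⊕ T)) (hE : IsClosed E) (x : Y) :
    IsOpen {u : X | Sum.inl (x, u) ∉ E ∧ Sum.inr (Sum.inl (u, x)) ∉ E} := by
  have h1 : Continuous (fun u : X => (Sum.inl (x, u) : (Y × X) ⊕ (X × Y) ⊕ T)) := by fun_prop
  have h2 : Continuous (fun u : X => (Sum.inr (Sum.inl (u, x)) : (Y × X) ⊕ (X × Y) ⊕ T)) := by
    fun_prop
  exact (hE.isOpen_compl.preimage h1).inter (hE.isOpen_compl.preimage h2)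

theorem aux_open' {X Y T : Type*} [TopologicalSpace X] [TopologicalSpace Y] [DiscreteTopology Y]
    [TopologicalSpace T] (U : Set X) (hU : IsOpen U) (x : Y) :
    IsOpen (Sum.inl '' (({x} : Set Y) ×ˢ U) : Set ((Y × X) ⊕ (X × Y) ⊕ T)) :=
  isOpenMap_inl _ ((isOpen_discrete _).prod hU)

open FreeAbelianGroup in
theorem aux_inj {X : Type*} {a b c d : X} (hcd : c ≠ d)
    (h : of a - of b = of c - of d) : a = c ∧ b = d := by
  classical
  have h1 := congrArg (FreeAbelianGroup.lift (fun z => if z = c then (1 : ℤ) else 0)) h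
  simp only [map_sub, lift_apply_of, if_true, if_neg hcd.symm] at h1
  have hac : a = c := by
    by_contra hne
    rw [if_neg hne] at h1
    split_ifs at h1 <;> omega
  subst hac
  exact ⟨rfl, of_injective (sub_right_injective h)⟩

open FreeAbelianGroup in
theorem aux_mem {X : Type*} (d : (X × X) ⊕ (X × X) ⊕ Unit) (h : theMap X d ≠ 0) :
    theMap X d ∈ LenTwoZero X := by
  rcases d with ⟨a, b⟩ | ⟨a, b⟩ | _
  · refine ⟨a, b, ?_, Or.inl rfl⟩
    rintro rfl
    exact h (by simp [theMap])
  · refine ⟨a, b, ?_, Or.inr rfl⟩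
    rintro rfl
    exact h (by simp [theMap])
  · exact absurd rfl h

open FreeAbelianGroup in
/-- Let `X` be a T1 space and endow the free abelian group `A` on `X` with a topology making
it the free abelian paratopological group `AP(X)` on `X`.  Let `f` be the natural map from
`(X_d × X) ⊕ (X × X_d) ⊕ {e}` (with the sum of the indicated product topologies) to `A`.
If the restriction of `f` over the set of words of reduced length exactly `2` (with
coefficient sum `0`) is an open map, then for every closed subset `E` of the domain whose
image avoids the words of length at most `1`, every word `w` of reduced length `2` lying in
the closure of `f(E)` belongs to `f(E)`. -/
theorem closed_image_on_length_two {X : Type*} [tX : TopologicalSpace X] [T1Space X]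
    (tA : TopologicalSpace (FreeAbelianGroup X))
    -- `A = AP(X)`: a paratopological group topology containing `X` ...
    (hadd : @ContinuousAdd (FreeAbelianGroup X) tA _)
    (hof : @Continuous X (FreeAbelianGroup X) tX tA of)
    -- ... with the universal extension property over paratopological groups
    (huniv : ∀ (H : Type*) [AddCommGroup H] [TopologicalSpace H] [ContinuousAdd H]
      (g : X → H), Continuous g →
        @Continuous (FreeAbelianGroup X) H tA _ (FreeAbelianGroup.lift g))
    -- the topology on the domain `(X_d × X) ⊕ (X × X_d) ⊕ {e}`
    (tD : TopologicalSpace ((X × X) ⊕ (X × X) ⊕ Unit))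
    (htD : tD = @instTopologicalSpaceSum (X × X) ((X × X) ⊕ Unit)
      (@instTopologicalSpaceProd X X ⊥ tX)
      (@instTopologicalSpaceSum (X × X) Unit (@instTopologicalSpaceProd X X tX ⊥) ⊥))
    -- the restriction of `f` over the words of reduced length exactly 2 is open
    (hopen : ∀ O : Set ((X × X) ⊕ (X × X) ⊕ Unit), @IsOpen _ tD O →
      ∃ G : Set (FreeAbelianGroup X), @IsOpen _ tA G ∧
        theMap X '' (O ∩ theMap X ⁻¹' LenTwoZero X) = G ∩ LenTwoZero X)
    (E : Set ((X × X) ⊕ (X × X) ⊕ Unit)) (hE : @IsClosed _ tD E)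
    (hE0 : ∀ d ∈ E, theMap X d ≠ 0) :
    ∀ w ∈ LenTwoZero X, w ∈ @closure _ tA (theMap X '' E) → w ∈ theMap X '' E := by
  intro w hw hcl
  subst htD
  obtain ⟨x, y, hxy, rfl⟩ : ∃ x y : X, x ≠ y ∧ w = of y - of x := by
    obtain ⟨x, y, hxy, h | h⟩ := hw
    · exact ⟨x, y, hxy, by rw [h]; abel⟩
    · exact ⟨y, x, hxy.symm, h⟩
  by_contra hnot
  have hUo := @aux_open X X Unit tX ⊥ ⊥ E hE x
  obtain ⟨G, hG, hGe⟩ := hopen _ (@aux_open' X X Unit tX ⊥ (@DiscreteTopology.mk X ⊥ rfl) ⊥ _ hUo x)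
  have hwG : of y - of x ∈ G ∩ LenTwoZero X := by
    rw [← hGe]
    have e1 : theMap X (Sum.inl (x, y)) = of y - of x := by simp only [theMap, Sum.elim_inl]; abel
    have e2 : theMap X (Sum.inr (Sum.inl (y, x))) = of y - of x := rfl
    refine ⟨Sum.inl (x, y), ⟨⟨(x, y), ⟨rfl, ?_, ?_⟩, rfl⟩, ?_⟩, e1⟩
    · exact fun h => hnot ⟨_, h, e1⟩
    · exact fun h => hnot ⟨_, h, e2⟩
    · rw [Set.mem_preimage, e1]; exact hw
  obtain ⟨_, hdG, d, hd, rfl⟩ := (@mem_closure_iff _ tA _ _).1 hcl G hG hwG.1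
  have hm : theMap X d ∈ G ∩ LenTwoZero X := ⟨hdG, aux_mem d (hE0 d hd)⟩
  rw [← hGe] at hm
  obtain ⟨_, ⟨⟨⟨x', u⟩, ⟨hx', hu1, hu2⟩, rfl⟩, -⟩, he⟩ := hm
  obtain rfl : x' = x := hx'
  have he' : of u - of x' = theMap X d := by
    rw [← he]; simp only [theMap, Sum.elim_inl]; abel
  have hne : u ≠ x' := by
    rintro rfl
    exact hE0 d hd (by rw [← he', sub_self])
  rcases d with ⟨a, b⟩ | ⟨a, b⟩ | _
  · have h3 : of b - of a = of u - of x' := by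
      rw [he']; simp only [theMap, Sum.elim_inl]; abel
    obtain ⟨rfl, rfl⟩ := aux_inj hne h3
    exact hu1 hd
  · have h3 : of a - of b = of u - of x' := by rw [he']; rfl
    obtain ⟨rfl, rfl⟩ := aux_inj hne h3
    exact hu2 hd
  · exact hE0 _ hd rfl
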